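/- arXiv:1310.7694 — 4 statements merged into one kernel-verified Lean document; each statement's English description precedes it below -/
import Mathlib

section
/- Let G be a group, let 𝔤 be a Lie algebra over ℝ, and let Ad : G → Aut(𝔤) be a group homomorphism from G to the group of Lie algebra automorphisms of 𝔤. Then the set G × 𝔤 × 𝔤 equipped with the multiplication (g, ξ, μ)·(h, η, ν) = (gh, ξ + Ad_g(η), μ + Ad_g(ν) + [ξ, Ad_g(η)]) is a group, with identity element (1, 0, 0) and with the inverse of (g, ξ, μ) given by (g⁻¹, −Ad_{g⁻¹}(ξ), −Ad_{g⁻¹}(μ)). -/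
/-- The multiplication of the second jet group `J²G = G × 𝔤 × 𝔤`:
`(g, ξ, μ) · (h, η, ν) = (gh, ξ + Ad_g η, μ + Ad_g ν + [ξ, Ad_g η])`. -/
def j2Mul {G 𝔤 : Type*} [Group G] [LieRing 𝔤] [LieAlgebra ℝ 𝔤]
    (Ad : G →* Module.End ℝ 𝔤) (p q : G × 𝔤 × 𝔤) : G × 𝔤 × 𝔤 :=
  (p.1 * q.1, p.2.1 + Ad p.1 q.2.1,
    p.2.2 + Ad p.1 q.2.2 + ⁅p.2.1, Ad p.1 q.2.1⁆)

/-- The candidate inverse in the second jet group: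
`(g, ξ, μ)⁻¹ = (g⁻¹, −Ad_{g⁻¹} ξ, −Ad_{g⁻¹} μ)`. -/
def j2Inv {G 𝔤 : Type*} [Group G] [LieRing 𝔤] [LieAlgebra ℝ 𝔤]
    (Ad : G →* Module.End ℝ 𝔤) (p : G × 𝔤 × 𝔤) : G × 𝔤 × 𝔤 :=
  (p.1⁻¹, -(Ad p.1⁻¹ p.2.1), -(Ad p.1⁻¹ p.2.2))

/-- Let `G` be a group, `𝔤` a real Lie algebra and `Ad : G → Aut(𝔤)` a homomorphism
to the group of Lie algebra automorphisms of `𝔤` (a monoid homomorphism of `G` into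
the endomorphisms of `𝔤`, each of which preserves the bracket; each `Ad g` is then
automatically invertible, with inverse `Ad g⁻¹`).  Then `G × 𝔤 × 𝔤` with the
multiplication `(g, ξ, μ)·(h, η, ν) = (gh, ξ + Ad_g(η), μ + Ad_g(ν) + [ξ, Ad_g(η)])`
is a group: the multiplication is associative, `(1, 0, 0)` is a two-sided identity,
and `(g⁻¹, −Ad_{g⁻¹}(ξ), −Ad_{g⁻¹}(μ))` is a two-sided inverse of `(g, ξ, μ)`. -/
theorem j2_group {G 𝔤 : Type*} [Group G] [LieRing 𝔤] [LieAlgebra ℝ 𝔤]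
    (Ad : G →* Module.End ℝ 𝔤)
    (hAd : ∀ (g : G) (x y : 𝔤), Ad g ⁅x, y⁆ = ⁅Ad g x, Ad g y⁆) :
    (∀ a b c : G × 𝔤 × 𝔤, j2Mul Ad (j2Mul Ad a b) c = j2Mul Ad a (j2Mul Ad b c)) ∧
    (∀ a : G × 𝔤 × 𝔤, j2Mul Ad ((1, 0, 0) : G × 𝔤 × 𝔤) a = a) ∧
    (∀ a : G × 𝔤 × 𝔤, j2Mul Ad a ((1, 0, 0) : G × 𝔤 × 𝔤) = a) ∧
    (∀ a : G × 𝔤 × 𝔤, j2Mul Ad a (j2Inv Ad a) = ((1, 0, 0) : G × 𝔤 × 𝔤)) ∧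
    (∀ a : G × 𝔤 × 𝔤, j2Mul Ad (j2Inv Ad a) a = ((1, 0, 0) : G × 𝔤 × 𝔤)) := by
  refine ⟨?_, ?_, ?_, ?_, ?_⟩
  · rintro ⟨g, ξ, μ⟩ ⟨h, η, ν⟩ ⟨k, ζ, ρ⟩
    simp only [j2Mul, map_mul, Module.End.mul_apply, map_add, hAd, lie_add, add_lie,
      Prod.mk.injEq]
    exact ⟨mul_assoc _ _ _, add_assoc _ _ _, by abel⟩
  · rintro ⟨g, ξ, μ⟩
    simp [j2Mul]
  · rintro ⟨g, ξ, μ⟩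
    simp [j2Mul]
  · rintro ⟨g, ξ, μ⟩
    simp [j2Mul, j2Inv, ← Module.End.mul_apply, ← map_mul]
  · rintro ⟨g, ξ, μ⟩
    simp [j2Mul, j2Inv]
end

section
/- Fix a natural number n, let G = GL(n, ℝ), let 𝔤 = Matrix n n ℝ with the commutator bracket, and let Ad be the conjugation action Ad_g(ξ) = g ξ g⁻¹. Equip G × 𝔤 × 𝔤 with the multiplication (g, ξ, μ)·(h, η, ν) = (gh, ξ + Ad_g(η), μ + Ad_g(ν) + [ξ, Ad_g(η)]). Let A = ℝ[X]/(X³). Then the map Φ sending (g, ξ, μ) to the class of the matrix (1 + Xξ + X²·(μ + ξ²)/2)·g in Matrix n n A takes values in the group of units of Matrix n n A, and Φ is a group isomorphism from G × 𝔤 × 𝔤 (with the above multiplication) onto the unit group of Matrix n n A. -/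
open Matrix Polynomial

/-- The ring `A = ℝ[X]/(X³)`. -/
noncomputable abbrev A3 : Type :=
  Polynomial ℝ ⧸ Ideal.span ({(X : Polynomial ℝ) ^ 3} : Set (Polynomial ℝ))

/-- The class of the variable `X` in `A = ℝ[X]/(X³)`. -/
noncomputable def xA : A3 :=
  Ideal.Quotient.mk (Ideal.span ({(X : Polynomial ℝ) ^ 3} : Set (Polynomial ℝ)))
    (X : Polynomial ℝ)

/-- The multiplication of the second jet group `GL(n, ℝ) × 𝔤 × 𝔤` with
`𝔤 = Matrix n n ℝ` (commutator bracket) and `Ad_g ξ = g ξ g⁻¹`: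
`(g, ξ, μ)·(h, η, ν) = (gh, ξ + Ad_g(η), μ + Ad_g(ν) + [ξ, Ad_g(η)])`. -/
def j2MulMat (n : ℕ)
    (p q : GL (Fin n) ℝ × Matrix (Fin n) (Fin n) ℝ × Matrix (Fin n) (Fin n) ℝ) :
    GL (Fin n) ℝ × Matrix (Fin n) (Fin n) ℝ × Matrix (Fin n) (Fin n) ℝ :=
  (p.1 * q.1,
    p.2.1 + (p.1 : Matrix (Fin n) (Fin n) ℝ) * q.2.1 *
      ((p.1⁻¹ : GL (Fin n) ℝ) : Matrix (Fin n) (Fin n) ℝ),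
    p.2.2 + (p.1 : Matrix (Fin n) (Fin n) ℝ) * q.2.2 *
      ((p.1⁻¹ : GL (Fin n) ℝ) : Matrix (Fin n) (Fin n) ℝ) +
      ⁅p.2.1, (p.1 : Matrix (Fin n) (Fin n) ℝ) * q.2.1 *
        ((p.1⁻¹ : GL (Fin n) ℝ) : Matrix (Fin n) (Fin n) ℝ)⁆)

/-- The map `Φ` sending `(g, ξ, μ)` to the matrix `(1 + X ξ + X²(μ + ξ²)/2) g` with
entries in `A = ℝ[X]/(X³)`. -/
noncomputable def phi3 (n : ℕ)
    (p : GL (Fin n) ℝ × Matrix (Fin n) (Fin n) ℝ × Matrix (Fin n) (Fin n) ℝ) :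
    Matrix (Fin n) (Fin n) A3 :=
  ((1 : Matrix (Fin n) (Fin n) A3) +
      xA • (p.2.1.map (algebraMap ℝ A3)) +
      (xA ^ 2) • ((((2 : ℝ)⁻¹ • (p.2.2 + p.2.1 * p.2.1)).map (algebraMap ℝ A3)))) *
    ((p.1 : Matrix (Fin n) (Fin n) ℝ).map (algebraMap ℝ A3))

/-- The class of `X` in `ℝ[X]/(X³)` has vanishing cube. -/
theorem xA_pow_three : xA ^ 3 = 0 := by
  rw [xA, ← map_pow]
  exact Ideal.Quotient.eq_zero_iff_mem.mpr (Ideal.mem_span_singleton_self _)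

theorem A3.exists_coeffs (z : A3) : ∃ a b c : ℝ,
    z = algebraMap ℝ A3 a + xA * algebraMap ℝ A3 b + xA ^ 2 * algebraMap ℝ A3 c := by
  obtain ⟨p, rfl⟩ := Ideal.Quotient.mk_surjective z
  refine ⟨p.coeff 0, p.divX.coeff 0, p.divX.divX.coeff 0, ?_⟩
  have hp : p = C (p.coeff 0) + X * C (p.divX.coeff 0) + X ^ 2 * C (p.divX.divX.coeff 0) +
      X ^ 3 * p.divX.divX.divX := by
    linear_combination -divX_mul_X_add p - X * divX_mul_X_add p.divX -
      X ^ 2 * divX_mul_X_add p.divX.divX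
  have h := congrArg
    (Ideal.Quotient.mk (Ideal.span ({(X : Polynomial ℝ) ^ 3} : Set (Polynomial ℝ)))) hp
  simp only [map_add, map_mul, map_pow] at h
  change _ = algebraMap ℝ A3 _ + xA * algebraMap ℝ A3 _ + xA ^ 2 * algebraMap ℝ A3 _ +
    xA ^ 3 * _ at h
  rw [h, xA_pow_three, zero_mul, add_zero]

theorem A3.coeffs_eq_zero {a b c : ℝ}
    (h : algebraMap ℝ A3 a + xA * algebraMap ℝ A3 b + xA ^ 2 * algebraMap ℝ A3 c = 0) :
    a = 0 ∧ b = 0 ∧ c = 0 := by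
  change Ideal.Quotient.mk (Ideal.span ({(X : Polynomial ℝ) ^ 3} : Set (Polynomial ℝ)))
    (C a + X * C b + X ^ 2 * C c) = 0 at h
  rw [Ideal.Quotient.eq_zero_iff_mem, Ideal.mem_span_singleton, X_pow_dvd_iff] at h
  have h0 := h 0 (by norm_num)
  have h1 := h 1 (by norm_num)
  have h2 := h 2 (by norm_num)
  simp [coeff_X_pow, coeff_C, coeff_X] at h0 h1 h2
  exact ⟨h0, h1, h2⟩

/-- The matrix `a + x b + x² c` over a commutative real algebra. -/
noncomputable def quadMatrix {n : ℕ} {R : Type*} [CommRing R] [Algebra ℝ R] (x : R)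
    (a b c : Matrix (Fin n) (Fin n) ℝ) : Matrix (Fin n) (Fin n) R :=
  a.map (algebraMap ℝ R) + x • b.map (algebraMap ℝ R) + x ^ 2 • c.map (algebraMap ℝ R)

theorem quadMatrix_mul {n : ℕ} {R : Type*} [CommRing R] [Algebra ℝ R] {x : R} (hx : x ^ 3 = 0)
    (a b c a' b' c' : Matrix (Fin n) (Fin n) ℝ) :
    quadMatrix x a b c * quadMatrix x a' b' c' =
      quadMatrix x (a * a') (a * b' + b * a') (a * c' + b * b' + c * a') := by
  have h3 : x * x ^ 2 = 0 := by rw [← hx]; ring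
  have h3' : x ^ 2 * x = 0 := by rw [← hx]; ring
  have h4 : x ^ 2 * x ^ 2 = 0 := by linear_combination x * hx
  simp only [quadMatrix, Matrix.map_add _ (map_add (algebraMap ℝ R)), Matrix.map_mul, add_mul,
    mul_add, smul_mul_assoc, mul_smul_comm, smul_smul, smul_add, h3, h3', h4, zero_smul, ← sq]
  abel

theorem quadMatrix_one_mul_map {n : ℕ} {R : Type*} [CommRing R] [Algebra ℝ R] (x : R)
    (b c g : Matrix (Fin n) (Fin n) ℝ) :
    (1 + x • b.map (algebraMap ℝ R) + x ^ 2 • c.map (algebraMap ℝ R)) * g.map (algebraMap ℝ R) =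
      quadMatrix x g (b * g) (c * g) := by
  simp only [quadMatrix, Matrix.map_mul, add_mul, one_mul, smul_mul_assoc]

/-- The matrix `a + X b + X² c` over `ℝ[X]/(X³)`. -/
noncomputable abbrev jetMatrix {n : ℕ} (a b c : Matrix (Fin n) (Fin n) ℝ) :
    Matrix (Fin n) (Fin n) A3 :=
  quadMatrix xA a b c

theorem jetMatrix_mul {n : ℕ} (a b c a' b' c' : Matrix (Fin n) (Fin n) ℝ) :
    jetMatrix a b c * jetMatrix a' b' c' =
      jetMatrix (a * a') (a * b' + b * a') (a * c' + b * b' + c * a') :=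
  quadMatrix_mul xA_pow_three a b c a' b' c'

theorem jetMatrix_one {n : ℕ} : jetMatrix (1 : Matrix (Fin n) (Fin n) ℝ) 0 0 = 1 := by
  simp [quadMatrix]

theorem jetMatrix_inj {n : ℕ} {a b c a' b' c' : Matrix (Fin n) (Fin n) ℝ}
    (h : jetMatrix a b c = jetMatrix a' b' c') : a = a' ∧ b = b' ∧ c = c' := by
  have key (i j : Fin n) : a i j - a' i j = 0 ∧ b i j - b' i j = 0 ∧ c i j - c' i j = 0 := by
    apply A3.coeffs_eq_zero
    have hij := congrFun (congrFun h i) j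
    simp only [quadMatrix, Matrix.add_apply, Matrix.smul_apply, Matrix.map_apply,
      smul_eq_mul] at hij
    simp only [map_sub]
    linear_combination hij
  refine ⟨?_, ?_, ?_⟩ <;> ext i j
  · exact sub_eq_zero.mp (key i j).1
  · exact sub_eq_zero.mp (key i j).2.1
  · exact sub_eq_zero.mp (key i j).2.2

theorem exists_eq_jetMatrix {n : ℕ} (M : Matrix (Fin n) (Fin n) A3) :
    ∃ a b c, M = jetMatrix a b c := by
  choose a b c h using fun i j => A3.exists_coeffs (M i j)
  refine ⟨Matrix.of a, Matrix.of b, Matrix.of c, ?_⟩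
  ext i j
  simpa [quadMatrix] using h i j

theorem phi3_eq_jetMatrix {n : ℕ} (g : GL (Fin n) ℝ) (ξ μ : Matrix (Fin n) (Fin n) ℝ) :
    phi3 n (g, ξ, μ) = jetMatrix g.val (ξ * g.val) ((2 : ℝ)⁻¹ • (μ + ξ * ξ) * g.val) :=
  quadMatrix_one_mul_map xA ξ _ g.val

theorem phi3_mul {n : ℕ}
    (p q : GL (Fin n) ℝ × Matrix (Fin n) (Fin n) ℝ × Matrix (Fin n) (Fin n) ℝ) :
    phi3 n (j2MulMat n p q) = phi3 n p * phi3 n q := by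
  obtain ⟨g, ξ, μ⟩ := p
  obtain ⟨h, η, ν⟩ := q
  have hg (M : Matrix (Fin n) (Fin n) ℝ) : (g⁻¹).val * (g.val * M) = M := by
    rw [← mul_assoc, Units.inv_mul, one_mul]
  simp only [j2MulMat, phi3_eq_jetMatrix, jetMatrix_mul, Units.val_mul]
  congr 1
  · simp only [add_mul, mul_assoc, hg]
    abel
  · simp only [Ring.lie_def, add_mul, mul_add, sub_mul, mul_assoc, hg, smul_mul_assoc,
      mul_smul_comm]
    module

theorem phi3_one {n : ℕ} : phi3 n (1, 0, 0) = 1 := by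
  rw [phi3_eq_jetMatrix, ← jetMatrix_one]
  simp

theorem isUnit_phi3 {n : ℕ}
    (p : GL (Fin n) ℝ × Matrix (Fin n) (Fin n) ℝ × Matrix (Fin n) (Fin n) ℝ) :
    IsUnit (phi3 n p) := by
  obtain ⟨g, ξ, μ⟩ := p
  have hg (M : Matrix (Fin n) (Fin n) ℝ) : g.val * ((g⁻¹).val * M) = M := by
    rw [← mul_assoc, Units.mul_inv, one_mul]
  refine IsUnit.of_mul_eq_one
    (phi3 n (g⁻¹, -((g⁻¹).val * ξ * g.val), -((g⁻¹).val * μ * g.val))) ?_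
  rw [← phi3_mul, ← phi3_one]
  congr 1
  simp only [j2MulMat, mul_neg, neg_mul, mul_assoc, Units.mul_inv, mul_one, hg, mul_inv_cancel,
    add_neg_cancel, Ring.lie_def, sub_self, add_zero]

theorem phi3_injective (n : ℕ) : Function.Injective (phi3 n) := by
  rintro ⟨g, ξ, μ⟩ ⟨h, η, ν⟩ hpq
  rw [phi3_eq_jetMatrix, phi3_eq_jetMatrix] at hpq
  obtain ⟨hgh, hξ, hμ⟩ := jetMatrix_inj hpq
  obtain rfl : g = h := Units.ext hgh
  obtain rfl : ξ = η := g.isUnit.mul_right_cancel hξ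
  have hμ' := smul_right_injective _ (inv_ne_zero (two_ne_zero' ℝ))
    (g.isUnit.mul_right_cancel hμ)
  obtain rfl : μ = ν := add_right_cancel hμ'
  rfl

theorem exists_phi3_eq {n : ℕ} (u : (Matrix (Fin n) (Fin n) A3)ˣ) :
    ∃ p, phi3 n p = (u : Matrix (Fin n) (Fin n) A3) := by
  obtain ⟨a, b, c, hu⟩ := exists_eq_jetMatrix u.val
  obtain ⟨a', b', c', hv⟩ := exists_eq_jetMatrix (u⁻¹).val
  have huv := u.mul_inv
  have hvu := u.inv_mul
  rw [hu, hv, jetMatrix_mul, ← jetMatrix_one] at huv hvu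
  have ha : a * a' = 1 := (jetMatrix_inj huv).1
  have ha' : a' * a = 1 := (jetMatrix_inj hvu).1
  refine ⟨(⟨a, a', ha, ha'⟩, b * a', (2 : ℝ) • (c * a') - b * a' * (b * a')), ?_⟩
  rw [hu, phi3_eq_jetMatrix, sub_add_cancel, inv_smul_smul₀ two_ne_zero]
  simp only [mul_assoc, ha', mul_one]

/-- With `G = GL(n, ℝ)`, `𝔤 = Matrix n n ℝ` with the commutator bracket,
`Ad_g(ξ) = g ξ g⁻¹`, and `A = ℝ[X]/(X³)`, the map
`Φ : (g, ξ, μ) ↦ (1 + Xξ + X²(μ + ξ²)/2) g` takes values in the group of units of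
`Matrix n n A`, and is a group isomorphism from `G × 𝔤 × 𝔤` with the second jet
multiplication onto the unit group of `Matrix n n A`: it is multiplicative,
injective, and every unit is in its image. -/
theorem phi3_group_iso (n : ℕ) :
    (∀ p, IsUnit (phi3 n p)) ∧
    (∀ p q, phi3 n (j2MulMat n p q) = phi3 n p * phi3 n q) ∧
    Function.Injective (phi3 n) ∧
    (∀ u : (Matrix (Fin n) (Fin n) A3)ˣ,
      ∃ p, phi3 n p = (u : Matrix (Fin n) (Fin n) A3)) := by
  exact ⟨isUnit_phi3, phi3_mul, phi3_injective n, exists_phi3_eq⟩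
end

section
/- Let Γ and G be groups, 𝔤 a Lie algebra over ℝ, Ad : G → Aut(𝔤) a homomorphism to the group of Lie algebra automorphisms of 𝔤, ρ₀ : Γ → G a group homomorphism, c, k : Γ → 𝔤 maps, and X a set on which Γ acts. Suppose F, F₂ : X → 𝔤 satisfy for all γ ∈ Γ and x ∈ X: F(γ·x) = Ad_{ρ₀(γ)}(F(x)) + c(γ) and F₂(γ·x) = Ad_{ρ₀(γ)}(F₂(x)) + [c(γ), Ad_{ρ₀(γ)}(F(x))] + k(γ). Let ξ, η ∈ 𝔤 satisfy Ad_{ρ₀(γ)}(ξ) = ξ and Ad_{ρ₀(γ)}(η) = η for all γ ∈ Γ. Then the pair F′ = F + ξ, F₂′ = F₂ + [F, ξ] + η (where [F, ξ](x) = [F(x), ξ]) satisfies the same two equivariance identities: F′(γ·x) = Ad_{ρ₀(γ)}(F′(x)) + c(γ) and F₂′(γ·x) = Ad_{ρ₀(γ)}(F₂′(x)) + [c(γ), Ad_{ρ₀(γ)}(F′(x))] + k(γ) for all γ ∈ Γ and x ∈ X. -/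
/-- Let `ρ₀ : Γ → G` be a homomorphism, `Ad : G → Aut(𝔤)` a homomorphism to the group
of Lie algebra automorphisms of the real Lie algebra `𝔤`, `c, k : Γ → 𝔤` maps, and `X`
a `Γ`-set.  Suppose `(F, F₂)` is `(ρ₀, c, k)`-equivariant, i.e.
`F (γ·x) = Ad_{ρ₀ γ}(F x) + c γ` and
`F₂ (γ·x) = Ad_{ρ₀ γ}(F₂ x) + [c γ, Ad_{ρ₀ γ}(F x)] + k γ`.
If `ξ, η ∈ 𝔤` are `Ad ∘ ρ₀`-invariant, then the pair `F' = F + ξ`,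
`F₂' = F₂ + [F, ξ] + η` satisfies the same two equivariance identities. -/
theorem translate_second_order_equivariant {Γ G 𝔤 X : Type*} [Group Γ] [Group G]
    [LieRing 𝔤] [LieAlgebra ℝ 𝔤] [MulAction Γ X]
    (Ad : G →* Module.End ℝ 𝔤)
    (hAd : ∀ (g : G) (x y : 𝔤), Ad g ⁅x, y⁆ = ⁅Ad g x, Ad g y⁆)
    (ρ₀ : Γ →* G) (c k : Γ → 𝔤)
    (F F₂ : X → 𝔤)
    (hF : ∀ (γ : Γ) (x : X), F (γ • x) = Ad (ρ₀ γ) (F x) + c γ)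
    (hF₂ : ∀ (γ : Γ) (x : X),
      F₂ (γ • x) = Ad (ρ₀ γ) (F₂ x) + ⁅c γ, Ad (ρ₀ γ) (F x)⁆ + k γ)
    (ξ η : 𝔤)
    (hξ : ∀ γ : Γ, Ad (ρ₀ γ) ξ = ξ)
    (hη : ∀ γ : Γ, Ad (ρ₀ γ) η = η) :
    (∀ (γ : Γ) (x : X), F (γ • x) + ξ = Ad (ρ₀ γ) (F x + ξ) + c γ) ∧
    (∀ (γ : Γ) (x : X),
      F₂ (γ • x) + ⁅F (γ • x), ξ⁆ + η =
        Ad (ρ₀ γ) (F₂ x + ⁅F x, ξ⁆ + η) +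
          ⁅c γ, Ad (ρ₀ γ) (F x + ξ)⁆ + k γ) := by
  refine ⟨fun γ x => ?_, fun γ x => ?_⟩
  · rw [hF, map_add, hξ]
    abel
  · rw [hF, hF₂]
    simp only [map_add, hAd, hξ, hη, add_lie, lie_add]
    abel
end

section
/- Let Γ and G be groups, 𝔤 a Lie algebra over ℝ, Ad : G → Aut(𝔤) a homomorphism to the group of Lie algebra automorphisms of 𝔤, ρ₀ : Γ → G a group homomorphism, c, k : Γ → 𝔤 maps, and X a nonempty set on which Γ acts. Suppose (F, F₂) and (F′, F₂′) are two pairs of maps X → 𝔤 each satisfying, for all γ ∈ Γ and x ∈ X, the identities F(γ·x) = Ad_{ρ₀(γ)}(F(x)) + c(γ) and F₂(γ·x) = Ad_{ρ₀(γ)}(F₂(x)) + [c(γ), Ad_{ρ₀(γ)}(F(x))] + k(γ) (and likewise for (F′, F₂′)). Assume further that F′ − F is the constant function with value ξ ∈ 𝔤 and that the function x ↦ F₂′(x) − F₂(x) − [F(x), ξ] is the constant function with value η ∈ 𝔤. Then ξ and η are invariant: Ad_{ρ₀(γ)}(ξ) = ξ and Ad_{ρ₀(γ)}(η) = η for all γ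 ∈ Γ. -/
/-- Let `ρ₀ : Γ → G` be a homomorphism, `Ad : G → Aut(𝔤)` a homomorphism to the group
of Lie algebra automorphisms of the real Lie algebra `𝔤`, `c, k : Γ → 𝔤` maps, and `X`
a nonempty `Γ`-set.  Suppose `(F, F₂)` and `(F', F₂')` are two `(ρ₀, c, k)`-equivariant
pairs of maps `X → 𝔤`, i.e. each satisfies `F (γ·x) = Ad_{ρ₀ γ}(F x) + c γ` and
`F₂ (γ·x) = Ad_{ρ₀ γ}(F₂ x) + [c γ, Ad_{ρ₀ γ}(F x)] + k γ`.  If `F' − F` is the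
constant `ξ` and `x ↦ F₂' x − F₂ x − [F x, ξ]` is the constant `η`, then `ξ` and `η`
are `Ad ∘ ρ₀`-invariant. -/
theorem second_order_difference_invariant {Γ G 𝔤 X : Type*} [Group Γ] [Group G]
    [LieRing 𝔤] [LieAlgebra ℝ 𝔤] [MulAction Γ X] [Nonempty X]
    (Ad : G →* Module.End ℝ 𝔤)
    (hAd : ∀ (g : G) (x y : 𝔤), Ad g ⁅x, y⁆ = ⁅Ad g x, Ad g y⁆)
    (ρ₀ : Γ →* G) (c k : Γ → 𝔤)
    (F F₂ F' F₂' : X → 𝔤)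
    (hF : ∀ (γ : Γ) (x : X), F (γ • x) = Ad (ρ₀ γ) (F x) + c γ)
    (hF₂ : ∀ (γ : Γ) (x : X),
      F₂ (γ • x) = Ad (ρ₀ γ) (F₂ x) + ⁅c γ, Ad (ρ₀ γ) (F x)⁆ + k γ)
    (hF' : ∀ (γ : Γ) (x : X), F' (γ • x) = Ad (ρ₀ γ) (F' x) + c γ)
    (hF₂' : ∀ (γ : Γ) (x : X),
      F₂' (γ • x) = Ad (ρ₀ γ) (F₂' x) + ⁅c γ, Ad (ρ₀ γ) (F' x)⁆ + k γ)
    (ξ η : 𝔤)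
    (hξ : ∀ x : X, F' x - F x = ξ)
    (hη : ∀ x : X, F₂' x - F₂ x - ⁅F x, ξ⁆ = η) :
    (∀ γ : Γ, Ad (ρ₀ γ) ξ = ξ) ∧ (∀ γ : Γ, Ad (ρ₀ γ) η = η) := by
  obtain ⟨x⟩ := ‹Nonempty X›
  have hξ_inv (γ : Γ) : Ad (ρ₀ γ) ξ = ξ := by
    calc Ad (ρ₀ γ) ξ = F' (γ • x) - F (γ • x) := by
          rw [hF, hF', ← hξ x, map_sub]; abel
      _ = ξ := hξ _
  refine ⟨hξ_inv, fun γ => ?_⟩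
  have hF'_eq : Ad (ρ₀ γ) (F' x) = Ad (ρ₀ γ) (F x) + ξ := by
    rw [← sub_eq_iff_eq_add', ← map_sub, hξ, hξ_inv]
  calc Ad (ρ₀ γ) η = F₂' (γ • x) - F₂ (γ • x) - ⁅F (γ • x), ξ⁆ := by
        rw [← hη x, map_sub, map_sub, hAd, hξ_inv, hF, hF₂, hF₂', hF'_eq, lie_add, add_lie]
        abel
    _ = η := hη _
end
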